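/- arXiv:1602.06577 — 6 statements merged into one kernel-verified Lean document; each statement's English description precedes it below -/
import Mathlib

section
/- For every real ρ with −1 < ρ < 1, the orthant probability of the standard bivariate normal distribution with correlation ρ satisfies ∫₀^∞ ∫₀^∞ f_ρ(x,y) dy dx = 1/4 + arcsin(ρ)/(2π). -/
open MeasureTheory Real

/-- Standard bivariate normal density with correlation `ρ`. -/
noncomputable def f (ρ x y : ℝ) : ℝ :=
  (1 / (2 * Real.pi * Real.sqrt (1 - ρ ^ 2))) *
    Real.exp (-(x ^ 2 - 2 * ρ * x * y + y ^ 2) / (2 * (1 - ρ ^ 2)))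

lemma aux1 (b : ℝ) (hb : 0 < b) :
    IntegrableOn (fun x : ℝ => x * Real.exp (-(b * x ^ 2))) (Set.Ioi 0) ∧
    ∫ x in Set.Ioi (0:ℝ), x * Real.exp (-(b * x ^ 2)) = 1 / (2 * b) := by
  have hd : ∀ x ∈ Set.Ici (0:ℝ),
      HasDerivAt (fun x : ℝ => -(Real.exp (-(b * x ^ 2)) / (2 * b)))
        (x * Real.exp (-(b * x ^ 2))) x := by
    intro x _
    have h := ((((hasDerivAt_pow 2 x).const_mul b).neg.exp).div_const (2 * b)).neg
    refine h.congr_deriv ?_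
    simp
    field_simp
  have hn : ∀ x ∈ Set.Ioi (0:ℝ), 0 ≤ x * Real.exp (-(b * x ^ 2)) := by
    intro x hx
    have : (0:ℝ) < x := hx
    positivity
  have ht : Filter.Tendsto (fun x : ℝ => -(Real.exp (-(b * x ^ 2)) / (2 * b))) Filter.atTop
      (nhds (-(0 / (2 * b)))) := by
    refine Filter.Tendsto.neg (Filter.Tendsto.div_const ?_ _)
    refine Real.tendsto_exp_neg_atTop_nhds_zero.comp ?_
    exact (Filter.tendsto_pow_atTop two_ne_zero).const_mul_atTop hb
  refine ⟨integrableOn_Ioi_deriv_of_nonneg' hd hn ht, ?_⟩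
  rw [integral_Ioi_of_hasDerivAt_of_nonneg' hd hn ht]
  simp

lemma aux2 (ρ s : ℝ) (hs : 0 < s) :
    IntegrableOn (fun t : ℝ => 1 / ((t - ρ) ^ 2 + s ^ 2)) (Set.Ioi 0) ∧
    ∫ t in Set.Ioi (0:ℝ), 1 / ((t - ρ) ^ 2 + s ^ 2)
      = (π / 2 + Real.arctan (ρ / s)) / s := by
  have hd : ∀ t ∈ Set.Ici (0:ℝ),
      HasDerivAt (fun t : ℝ => Real.arctan ((t - ρ) / s) / s)
        (1 / ((t - ρ) ^ 2 + s ^ 2)) t := by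
    intro t _
    have h := ((((hasDerivAt_id t).sub_const ρ).div_const s).arctan).div_const s
    refine h.congr_deriv ?_
    have : (t - ρ) ^ 2 + s ^ 2 ≠ 0 := by positivity
    have : s ^ 2 + (t - ρ) ^ 2 ≠ 0 := by positivity
    simp
    field_simp
    ring
  have hn : ∀ t ∈ Set.Ioi (0:ℝ), 0 ≤ 1 / ((t - ρ) ^ 2 + s ^ 2) := by
    intro t _
    positivity
  have ht : Filter.Tendsto (fun t : ℝ => Real.arctan ((t - ρ) / s) / s) Filter.atTop
      (nhds ((π / 2) / s)) := by
    refine Filter.Tendsto.div_const ?_ _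
    refine (Real.tendsto_arctan_atTop.mono_right nhdsWithin_le_nhds).comp ?_
    exact (Filter.tendsto_atTop_add_const_right _ (-ρ) Filter.tendsto_id).atTop_div_const hs
  refine ⟨integrableOn_Ioi_deriv_of_nonneg' hd hn ht, ?_⟩
  rw [integral_Ioi_of_hasDerivAt_of_nonneg' hd hn ht]
  rw [zero_sub, neg_div, Real.arctan_neg]
  ring

theorem stmt0 (ρ : ℝ) (h1 : -1 < ρ) (h2 : ρ < 1) :
    (∫ x in Set.Ioi (0:ℝ), ∫ y in Set.Ioi (0:ℝ), f ρ x y) =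
      1 / 4 + Real.arcsin ρ / (2 * Real.pi) := by
  have hp : 0 < 1 - ρ ^ 2 := by nlinarith
  obtain ⟨s, hs⟩ : ∃ s, s = Real.sqrt (1 - ρ ^ 2) := ⟨_, rfl⟩
  have hs0 : 0 < s := by rw [hs]; exact Real.sqrt_pos.2 hp
  have hs2 : s ^ 2 = 1 - ρ ^ 2 := by rw [hs]; exact Real.sq_sqrt hp.le
  have hb : ∀ t : ℝ, 0 < ((t - ρ) ^ 2 + s ^ 2) / (2 * s ^ 2) := fun t => by positivity
  let g : ℝ → ℝ → ℝ := fun x t => x * Real.exp (-(((t - ρ) ^ 2 + s ^ 2) / (2 * s ^ 2) * x ^ 2))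
  have hval : ∀ t : ℝ, ∫ x in Set.Ioi (0:ℝ), g x t = s ^ 2 * (1 / ((t - ρ) ^ 2 + s ^ 2)) := by
    intro t
    rw [(aux1 _ (hb t)).2]
    field_simp
  have hint : Integrable (Function.uncurry g)
      ((volume.restrict (Set.Ioi 0)).prod (volume.restrict (Set.Ioi 0))) := by
    have hc : Continuous (Function.uncurry g) := by
      simp only [g, Function.uncurry_def]
      fun_prop
    rw [integrable_prod_iff' hc.aestronglyMeasurable]
    refine ⟨Filter.Eventually.of_forall fun t => (aux1 _ (hb t)).1, ?_⟩
    refine ((aux2 ρ s hs0).1.const_mul (s ^ 2)).congr (Filter.Eventually.of_forall fun t => ?_)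
    simp only []
    rw [← hval t]
    refine setIntegral_congr_fun measurableSet_Ioi fun x hx => ?_
    have : (0:ℝ) < x := hx
    simp only [Function.uncurry]
    rw [Real.norm_of_nonneg]
    simp only [g]
    positivity
  have hinner : ∀ x ∈ Set.Ioi (0:ℝ), ∫ y in Set.Ioi (0:ℝ), f ρ x y
      = 1 / (2 * π * s) * ∫ t in Set.Ioi (0:ℝ), g x t := by
    intro x hx
    have hx0 : (0:ℝ) < x := hx
    have h := integral_comp_mul_left_Ioi (fun y => f ρ x y) 0 hx0
    rw [mul_zero, smul_eq_mul] at h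
    have h' : ∫ y in Set.Ioi (0:ℝ), f ρ x y = x * ∫ t in Set.Ioi (0:ℝ), f ρ x (x * t) := by
      rw [h]; field_simp
    rw [h', ← integral_const_mul, ← integral_const_mul]
    congr 1
    ext t
    simp only [f, g]
    rw [← hs, ← hs2]
    have : -(x ^ 2 - 2 * ρ * x * (x * t) + (x * t) ^ 2) / (2 * s ^ 2)
        = -(((t - ρ) ^ 2 + s ^ 2) / (2 * s ^ 2) * x ^ 2) := by
      have : (t - ρ) ^ 2 + s ^ 2 = t ^ 2 - 2 * ρ * t + 1 := by rw [hs2]; ring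
      rw [this]
      ring
    rw [this]
    ring
  rw [setIntegral_congr_fun measurableSet_Ioi hinner, integral_const_mul,
    integral_integral_swap hint]
  simp_rw [hval]
  rw [integral_const_mul, (aux2 ρ s hs0).2, Real.arcsin_eq_arctan ⟨h1, h2⟩, ← hs]
  field_simp
  ring
end

section
/- For every w > 0 and every ρ with −1 < ρ < 1, the function ρ ↦ P₂₂(ρ,w) is differentiable at ρ with derivative (1/(2π)) · (1/√(1−ρ²)) · [ 1 − 2·exp(−w²/(2(1−ρ²))) + exp(−w²/(1+ρ)) ]. -/
open MeasureTheory Real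

/-- Standard normal density. -/
noncomputable def stdPhi (x : ℝ) : ℝ := (1 / Real.sqrt (2 * Real.pi)) * Real.exp (-x ^ 2 / 2)

/-- Standard normal distribution function. -/
noncomputable def stdCdf (x : ℝ) : ℝ := ∫ t in Set.Iic x, stdPhi t

noncomputable def P22 (ρ w : ℝ) : ℝ := ∫ x in (0:ℝ)..w, ∫ y in (0:ℝ)..w, f ρ x y


lemma aux_L (F F' : ℝ → ℝ → ℝ) (a b ρ w : ℝ) (hw : 0 < w) (ha : a < ρ) (hb : ρ < b)
    (hF : ∀ r ∈ Set.Icc a b, Continuous (F r))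
    (hF' : ContinuousOn (fun p : ℝ × ℝ => F' p.1 p.2) (Set.Icc a b ×ˢ Set.Icc 0 w))
    (hd : ∀ r ∈ Set.Icc a b, ∀ x, HasDerivAt (fun r => F r x) (F' r x) r) :
    HasDerivAt (fun r => ∫ x in (0:ℝ)..w, F r x) (∫ x in (0:ℝ)..w, F' ρ x) ρ := by
  obtain ⟨C, hC⟩ := (isCompact_Icc.prod isCompact_Icc).exists_bound_of_continuousOn hF'
  have hmem : ρ ∈ Set.Icc a b := ⟨ha.le, hb.le⟩
  have hcρ : ContinuousOn (F' ρ) (Set.Icc 0 w) := by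
    have : ContinuousOn (fun x : ℝ => ((ρ, x) : ℝ × ℝ)) (Set.Icc 0 w) := by fun_prop
    exact hF'.comp this (fun x hx => ⟨hmem, hx⟩)
  refine (intervalIntegral.hasDerivAt_integral_of_dominated_loc_of_deriv_le
    (F := F) (F' := F') (bound := fun _ => C) (s := Set.Icc a b) (Icc_mem_nhds ha hb) ?_ ?_ ?_ ?_ ?_ ?_).2
  · filter_upwards [Icc_mem_nhds ha hb] with r hr
    exact (hF r hr).aestronglyMeasurable
  · exact (hF ρ hmem).intervalIntegrable _ _
  · rw [Set.uIoc_of_le hw.le]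
    exact (hcρ.mono Set.Ioc_subset_Icc_self).aestronglyMeasurable measurableSet_Ioc
  · refine Filter.Eventually.of_forall fun x hx r hr => ?_
    rw [Set.uIoc_of_le hw.le] at hx
    exact hC (r, x) ⟨hr, Set.Ioc_subset_Icc_self hx⟩
  · exact intervalIntegrable_const
  · exact Filter.Eventually.of_forall fun x _ r hr => hd r hr x

lemma aux_sqrt (r : ℝ) (hs : 0 < 1 - r ^ 2) : 0 < Real.sqrt (1 - r ^ 2) := Real.sqrt_pos.2 hs

noncomputable def hh (r x y : ℝ) : ℝ := f r x y * ((r * y - x) / (1 - r ^ 2))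
noncomputable def gg (r x y : ℝ) : ℝ :=
  f r x y * ((r * y - x) * (r * x - y) / (1 - r ^ 2) ^ 2 + r / (1 - r ^ 2))

lemma f_dx (r x y : ℝ) (hs : 0 < 1 - r ^ 2) : HasDerivAt (fun x => f r x y) (hh r x y) x := by
  unfold f hh f
  have h : HasDerivAt (fun x : ℝ => -(x ^ 2 - 2 * r * x * y + y ^ 2) / (2 * (1 - r ^ 2)))
      ((r * y - x) / (1 - r ^ 2)) x := by
    have h0 := (((((hasDerivAt_id x).pow 2).sub (((hasDerivAt_id x).const_mul (2 * r)).mul_const y)).add_const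
      (y ^ 2)).neg).div_const (2 * (1 - r ^ 2))
    refine h0.congr_deriv ?_
    simp only [id]
    field_simp
    ring
  exact (h.exp.const_mul _).congr_deriv (by ring)

lemma f_symm (r x y : ℝ) : f r x y = f r y x := by
  unfold f; ring_nf

lemma f_dy (r x y : ℝ) (hs : 0 < 1 - r ^ 2) :
    HasDerivAt (fun y => f r x y) (f r x y * ((r * x - y) / (1 - r ^ 2))) y := by
  have := f_dx r y x hs
  unfold hh at this
  rw [f_symm r y x] at this
  simpa only [f_symm r _ x] using this

lemma hh_dy (r x y : ℝ) (hs : 0 < 1 - r ^ 2) : HasDerivAt (fun y => hh r x y) (gg r x y) y := by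
  unfold hh gg
  have h : HasDerivAt (fun y : ℝ => (r * y - x) / (1 - r ^ 2)) (r / (1 - r ^ 2)) y := by
    have h0 := (((hasDerivAt_id y).const_mul r).sub_const x).div_const (1 - r ^ 2)
    simpa using h0
  refine ((f_dy r x y hs).mul h).congr_deriv ?_
  field_simp

lemma f_dr (r x y : ℝ) (hs : 0 < 1 - r ^ 2) : HasDerivAt (fun r => f r x y) (gg r x y) r := by
  have hq := aux_sqrt r hs
  have hpi := Real.pi_pos
  unfold gg f
  have hS : HasDerivAt (fun r : ℝ => 1 - r ^ 2) (-(2 * r)) r := by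
    simpa using ((hasDerivAt_id r).pow 2).const_sub 1
  have h1 : HasDerivAt (fun r : ℝ => -(x ^ 2 - 2 * r * x * y + y ^ 2) / (2 * (1 - r ^ 2)))
      ((x * y * (1 - r ^ 2) - r * (x ^ 2 - 2 * r * x * y + y ^ 2)) / (1 - r ^ 2) ^ 2) r := by
    have hN : HasDerivAt (fun r : ℝ => -(x ^ 2 - 2 * r * x * y + y ^ 2)) (2 * x * y) r := by
      have h0 := ((((((hasDerivAt_id r).const_mul 2).mul_const x).mul_const y).const_sub (x ^ 2)).add_const (y ^ 2)).neg
      refine h0.congr_deriv ?_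
      ring
    refine (hN.div (hS.const_mul 2) (by positivity)).congr_deriv ?_
    field_simp
  have h2 : HasDerivAt (fun r : ℝ => 1 / (2 * Real.pi * Real.sqrt (1 - r ^ 2)))
      (1 / (2 * Real.pi * Real.sqrt (1 - r ^ 2)) * (r / (1 - r ^ 2))) r := by
    have h0 := ((hS.sqrt hs.ne').const_mul (2 * Real.pi)).inv (by positivity)
    simp only [one_div]
    refine h0.congr_deriv ?_
    have e := Real.sq_sqrt hs.le
    generalize Real.sqrt (1 - r ^ 2) = q at *
    rw [← e]
    field_simp
  refine (h2.mul h1.exp).congr_deriv ?_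
  field_simp
  ring

lemma f_contOn (a b : ℝ) (hs : ∀ r ∈ Set.Icc a b, 0 < 1 - r ^ 2) :
    ContinuousOn (fun p : ℝ × ℝ × ℝ => f p.1 p.2.1 p.2.2) (Set.Icc a b ×ˢ Set.univ) := by
  have hpi := Real.pi_pos
  unfold f
  refine ContinuousOn.mul (ContinuousOn.div (by fun_prop) (by fun_prop) ?_)
    (ContinuousOn.rexp (ContinuousOn.div (by fun_prop) (by fun_prop) ?_))
  · intro p hp
    have := aux_sqrt _ (hs p.1 hp.1)
    positivity
  · intro p hp
    have := hs p.1 hp.1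
    positivity

lemma hh_contOn (a b : ℝ) (hs : ∀ r ∈ Set.Icc a b, 0 < 1 - r ^ 2) :
    ContinuousOn (fun p : ℝ × ℝ × ℝ => hh p.1 p.2.1 p.2.2) (Set.Icc a b ×ˢ Set.univ) := by
  unfold hh
  refine (f_contOn a b hs).mul (ContinuousOn.div (by fun_prop) (by fun_prop) ?_)
  intro p hp
  exact (hs p.1 hp.1).ne'

lemma gg_contOn (a b : ℝ) (hs : ∀ r ∈ Set.Icc a b, 0 < 1 - r ^ 2) :
    ContinuousOn (fun p : ℝ × ℝ × ℝ => gg p.1 p.2.1 p.2.2) (Set.Icc a b ×ˢ Set.univ) := by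
  unfold gg
  refine (f_contOn a b hs).mul ((ContinuousOn.div (by fun_prop) (by fun_prop) ?_).add
    (ContinuousOn.div (by fun_prop) (by fun_prop) ?_))
  · intro p hp
    have := (hs p.1 hp.1)
    positivity
  · intro p hp
    exact (hs p.1 hp.1).ne'

lemma f_cont (r : ℝ) : Continuous (fun p : ℝ × ℝ => f r p.1 p.2) := by
  unfold f; fun_prop

lemma gg_cont (r : ℝ) : Continuous (fun p : ℝ × ℝ => gg r p.1 p.2) := by
  unfold gg f; fun_prop

lemma hh_cont (r : ℝ) : Continuous (fun p : ℝ × ℝ => hh r p.1 p.2) := by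
  unfold hh f; fun_prop

set_option maxHeartbeats 1000000 in
theorem stmt7 (w : ℝ) (hw : 0 < w) (ρ : ℝ) (h1 : -1 < ρ) (h2 : ρ < 1) :
    HasDerivAt (fun r => P22 r w)
      ((1 / (2 * Real.pi)) * (1 / Real.sqrt (1 - ρ ^ 2)) *
        (1 - 2 * Real.exp (-w ^ 2 / (2 * (1 - ρ ^ 2))) + Real.exp (-w ^ 2 / (1 + ρ)))) ρ := by
  have inner : ∀ r, -1 < r → r < 1 → ∀ x,
      HasDerivAt (fun r => ∫ y in (0:ℝ)..w, f r x y) (hh r x w - hh r x 0) r := by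
    intro r hr1 hr2 x
    have hs : ∀ t ∈ Set.Icc ((r - 1) / 2) ((r + 1) / 2), 0 < 1 - t ^ 2 := by
      rintro t ⟨h, h'⟩
      nlinarith
    have hsr : 0 < 1 - r ^ 2 := by nlinarith
    have e : ∫ y in (0:ℝ)..w, gg r x y = hh r x w - hh r x 0 :=
      intervalIntegral.integral_eq_sub_of_hasDerivAt (fun y _ => hh_dy r x y hsr)
        (((gg_cont r).comp (by fun_prop : Continuous fun y : ℝ => (x, y))).intervalIntegrable _ _)
    rw [← e]
    refine aux_L (fun r y => f r x y) (fun r y => gg r x y) ((r - 1) / 2) ((r + 1) / 2) r w hw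
      (by linarith) (by linarith) ?_ ?_ ?_
    · intro t _
      exact (f_cont t).comp (by fun_prop : Continuous fun y : ℝ => (x, y))
    · exact ContinuousOn.comp (g := fun p : ℝ × ℝ × ℝ => gg p.1 p.2.1 p.2.2)
        (f := fun p : ℝ × ℝ => (p.1, x, p.2)) (gg_contOn _ _ hs)
        (Continuous.continuousOn (by fun_prop)) (fun p hp => ⟨hp.1, trivial⟩)
    · intro t ht y
      exact f_dr t x y (hs t ht)
  have hs : ∀ t ∈ Set.Icc ((ρ - 1) / 2) ((ρ + 1) / 2), 0 < 1 - t ^ 2 := by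
    rintro t ⟨h, h'⟩
    nlinarith
  have hsr : 0 < 1 - ρ ^ 2 := by nlinarith
  have outer : HasDerivAt (fun r => P22 r w) (∫ x in (0:ℝ)..w, (hh ρ x w - hh ρ x 0)) ρ := by
    refine aux_L (fun r x => ∫ y in (0:ℝ)..w, f r x y) (fun r x => hh r x w - hh r x 0)
      ((ρ - 1) / 2) ((ρ + 1) / 2) ρ w hw (by linarith) (by linarith) ?_ ?_ ?_
    · intro t _
      exact intervalIntegral.continuous_parametric_intervalIntegral_of_continuous' (f_cont t) 0 w
    · have k : ∀ c : ℝ, ContinuousOn (fun p : ℝ × ℝ => hh p.1 p.2 c)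
          (Set.Icc ((ρ - 1) / 2) ((ρ + 1) / 2) ×ˢ Set.Icc 0 w) := fun c =>
        ContinuousOn.comp (g := fun p : ℝ × ℝ × ℝ => hh p.1 p.2.1 p.2.2)
          (f := fun p : ℝ × ℝ => (p.1, p.2, c)) (hh_contOn _ _ hs)
          (Continuous.continuousOn (by fun_prop)) (fun p hp => ⟨hp.1, trivial⟩)
      exact (k w).sub (k 0)
    · intro t ht x
      exact inner t (by linarith [ht.1]) (by linarith [ht.2]) x
  refine outer.congr_deriv ?_
  have k : ∀ c : ℝ, Continuous (fun x : ℝ => hh ρ x c) := fun c =>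
    (hh_cont ρ).comp (by fun_prop : Continuous fun x : ℝ => (x, c))
  rw [intervalIntegral.integral_eq_sub_of_hasDerivAt
    (f := fun x => f ρ x w - f ρ x 0)
    (fun x _ => (f_dx ρ x w hsr).sub (f_dx ρ x 0 hsr))
    (((k w).sub (k 0)).intervalIntegrable _ _)]
  have e1 : -(w ^ 2 - 2 * ρ * w * w + w ^ 2) / (2 * (1 - ρ ^ 2)) = -w ^ 2 / (1 + ρ) := by
    have : 0 < 1 + ρ := by linarith
    rw [div_eq_div_iff (by positivity) (by positivity)]
    ring
  have e2 : -(w ^ 2 - 2 * ρ * w * 0 + 0 ^ 2) / (2 * (1 - ρ ^ 2)) = -w ^ 2 / (2 * (1 - ρ ^ 2)) := by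
    ring
  have e3 : -(0 ^ 2 - 2 * ρ * 0 * w + w ^ 2) / (2 * (1 - ρ ^ 2)) = -w ^ 2 / (2 * (1 - ρ ^ 2)) := by
    ring
  have e4 : -((0:ℝ) ^ 2 - 2 * ρ * 0 * 0 + 0 ^ 2) / (2 * (1 - ρ ^ 2)) = 0 := by
    simp
  unfold f
  rw [e1, e2, e3, e4, Real.exp_zero]
  have hq := aux_sqrt ρ hsr
  field_simp
  ring
end

section
/- For every w > 0 and every ρ with −1 < ρ < 1, the function ρ ↦ P₂₃(ρ,w) is differentiable at ρ with derivative (1/(2π)) · (1/√(1−ρ²)) · [ exp(−w²/(2(1−ρ²))) − exp(−w²/(1+ρ)) ]. -/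
open MeasureTheory Real

noncomputable def P23 (ρ w : ℝ) : ℝ := ∫ x in (0:ℝ)..w, ∫ y in Set.Ioi w, f ρ x y


noncomputable def HH (t : ℝ) : ℝ := ∫ y in Set.Ioi t, Real.exp (-y ^ 2 / 2)

lemma gg_integrable : Integrable (fun y : ℝ => Real.exp (-y ^ 2 / 2)) := by
  have := integrable_exp_neg_mul_sq (b := 1 / 2) (by norm_num)
  refine this.congr (Filter.Eventually.of_forall fun y => ?_)
  simp only
  congr 1
  ring

lemma HH_deriv (t : ℝ) : HasDerivAt HH (-Real.exp (-t ^ 2 / 2)) t := by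
  have hc : Continuous (fun y : ℝ => Real.exp (-y ^ 2 / 2)) := by fun_prop
  have h : HH = fun u => HH 0 - ∫ y in (0:ℝ)..u, Real.exp (-y ^ 2 / 2) := by
    funext u
    have := intervalIntegral.integral_interval_add_Ioi (a := 0) (b := u)
      gg_integrable.integrableOn gg_integrable.integrableOn
    simp only [HH]
    linarith
  rw [h]
  exact (intervalIntegral.integral_hasDerivAt_right (hc.intervalIntegrable _ _)
    hc.stronglyMeasurable.stronglyMeasurableAtFilter hc.continuousAt).const_sub _

lemma shift_Ioi (g : ℝ → ℝ) (a c : ℝ) :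
    ∫ y in Set.Ioi a, g (y - c) = ∫ y in Set.Ioi (a - c), g y := by
  rw [← integral_indicator measurableSet_Ioi, ← integral_indicator measurableSet_Ioi,
    ← integral_sub_right_eq_self ((Set.Ioi (a - c)).indicator _) c]
  congr 1
  ext y
  simp [Set.indicator]

lemma inner_eq (r x w : ℝ) (hr : 0 < 1 - r ^ 2) :
    ∫ y in Set.Ioi w, f r x y =
      (1 / (2 * Real.pi)) * Real.exp (-x ^ 2 / 2) * HH ((Real.sqrt (1 - r ^ 2))⁻¹ * (w - r * x)) := by
  have hs : 0 < Real.sqrt (1 - r ^ 2) := Real.sqrt_pos.2 hr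
  have hs2 : Real.sqrt (1 - r ^ 2) ^ 2 = 1 - r ^ 2 := Real.sq_sqrt hr.le
  have h : ∀ y, f r x y = (1 / (2 * Real.pi * Real.sqrt (1 - r ^ 2)) * Real.exp (-x ^ 2 / 2)) *
      (fun z => (fun t => Real.exp (-t ^ 2 / 2)) ((Real.sqrt (1 - r ^ 2))⁻¹ * z)) (y - r * x) := by
    intro y
    simp only [f]
    rw [mul_assoc (1 / (2 * Real.pi * Real.sqrt (1 - r ^ 2))) (Real.exp _), ← Real.exp_add]
    congr 2
    rw [mul_pow, inv_pow, hs2]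
    field_simp
    ring
  simp_rw [h]
  rw [integral_const_mul, shift_Ioi (fun z => (fun t => Real.exp (-t ^ 2 / 2)) ((Real.sqrt (1 - r ^ 2))⁻¹ * z)),
    integral_comp_mul_left_Ioi (fun t => Real.exp (-t ^ 2 / 2)) _ (inv_pos.2 hs)]
  simp only [HH, smul_eq_mul, inv_inv]
  field_simp

lemma inner_deriv (r x w : ℝ) (hr : 0 < 1 - r ^ 2) :
    HasDerivAt (fun r => (1 / (2 * Real.pi)) * Real.exp (-x ^ 2 / 2) *
      HH ((Real.sqrt (1 - r ^ 2))⁻¹ * (w - r * x))) (f r x w * (x - r * w) / (1 - r ^ 2)) r := by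
  have hs : 0 < Real.sqrt (1 - r ^ 2) := Real.sqrt_pos.2 hr
  have hs2 : Real.sqrt (1 - r ^ 2) ^ 2 = 1 - r ^ 2 := Real.sq_sqrt hr.le
  have e1 : HasDerivAt (fun r : ℝ => 1 - r ^ 2) (-(2 * r)) r := by
    simpa using (hasDerivAt_pow 2 r).const_sub 1
  have e2 := (e1.sqrt hr.ne').inv hs.ne'
  have e3 : HasDerivAt (fun r : ℝ => w - r * x) (-x) r := by
    simpa using ((hasDerivAt_id r).mul_const x).const_sub w
  have e4 := ((HH_deriv _).comp r (e2.mul e3)).const_mul (1 / (2 * Real.pi) * Real.exp (-x ^ 2 / 2))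
  refine e4.congr_deriv ?_
  have hE : Real.exp (-(x ^ 2 - 2 * r * x * w + w ^ 2) / (2 * (1 - r ^ 2))) =
      Real.exp (-x ^ 2 / 2) * Real.exp (-((Real.sqrt (1 - r ^ 2))⁻¹ * (w - r * x)) ^ 2 / 2) := by
    rw [← Real.exp_add]
    congr 1
    rw [mul_pow, inv_pow, hs2]
    field_simp
    ring
  simp only [f, Pi.mul_apply, Pi.inv_apply]
  rw [hE]
  generalize Real.exp (-((Real.sqrt (1 - r ^ 2))⁻¹ * (w - r * x)) ^ 2 / 2) = E
  generalize Real.exp (-x ^ 2 / 2) = E'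
  rw [hs2]
  have hq : (Real.sqrt (1 - r ^ 2))⁻¹ * (-x) =
      (-x) * (1 - r ^ 2) / (Real.sqrt (1 - r ^ 2) * (1 - r ^ 2)) := by
    field_simp
  rw [hq]
  field_simp
  ring

lemma f_deriv (r x w : ℝ) (hr : 0 < 1 - r ^ 2) :
    HasDerivAt (fun x => - f r x w) (f r x w * (x - r * w) / (1 - r ^ 2)) x := by
  have e1 : HasDerivAt (fun x : ℝ => x ^ 2 - 2 * r * x * w + w ^ 2) (2 * x - 2 * r * w) x := by
    have := (((hasDerivAt_pow 2 x).sub (((hasDerivAt_id x).const_mul (2 * r)).mul_const w)).add_const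
      (w ^ 2))
    simpa using this
  have e2 := ((((e1.neg).div_const (2 * (1 - r ^ 2))).exp).const_mul
    (1 / (2 * Real.pi * Real.sqrt (1 - r ^ 2)))).neg
  refine e2.congr_deriv ?_
  simp only [f, Pi.neg_apply]
  have hs : 0 < Real.sqrt (1 - r ^ 2) := Real.sqrt_pos.2 hr
  field_simp

theorem stmt8 (w : ℝ) (hw : 0 < w) (ρ : ℝ) (h1 : -1 < ρ) (h2 : ρ < 1) :
    HasDerivAt (fun r => P23 r w)
      ((1 / (2 * Real.pi)) * (1 / Real.sqrt (1 - ρ ^ 2)) *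
        (Real.exp (-w ^ 2 / (2 * (1 - ρ ^ 2))) - Real.exp (-w ^ 2 / (1 + ρ)))) ρ := by
  have hρ : 0 < 1 - ρ ^ 2 := by nlinarith
  set K : Set ℝ := Set.Icc ((ρ - 1) / 2) ((ρ + 1) / 2) with hK
  have hKn : K ∈ nhds ρ := Icc_mem_nhds (by linarith) (by linarith)
  have hKp : ∀ r ∈ K, 0 < 1 - r ^ 2 := by
    rintro r ⟨ha, hb⟩
    nlinarith
  have hHc : Continuous HH := continuous_iff_continuousAt.2 fun t => (HH_deriv t).continuousAt
  have hFc : ∀ r, Continuous (fun x => (1 / (2 * Real.pi)) * Real.exp (-x ^ 2 / 2) *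
      HH ((Real.sqrt (1 - r ^ 2))⁻¹ * (w - r * x))) := by
    intro r
    fun_prop
  have hF'c : Continuous (fun x => f ρ x w * (x - ρ * w) / (1 - ρ ^ 2)) := by
    unfold f
    fun_prop
  have hcont : ContinuousOn (fun p : ℝ × ℝ => f p.1 p.2 w * (p.2 - p.1 * w) / (1 - p.1 ^ 2))
      (K ×ˢ Set.Icc 0 w) := by
    unfold f
    have hne : ∀ p ∈ K ×ˢ Set.Icc 0 w, 1 - p.1 ^ 2 ≠ 0 := fun p hp => (hKp p.1 hp.1).ne'
    have hne2 : ∀ p ∈ K ×ˢ Set.Icc 0 w, 2 * (1 - p.1 ^ 2) ≠ 0 := fun p hp =>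
      mul_ne_zero two_ne_zero (hne p hp)
    have hne3 : ∀ p ∈ K ×ˢ Set.Icc 0 w, 2 * Real.pi * Real.sqrt (1 - p.1 ^ 2) ≠ 0 := fun p hp =>
      mul_ne_zero (by positivity) (Real.sqrt_pos.2 (hKp p.1 hp.1)).ne'
    refine ContinuousOn.div (ContinuousOn.mul (ContinuousOn.mul
      (ContinuousOn.div (by fun_prop) (by fun_prop) hne3)
      (ContinuousOn.rexp (ContinuousOn.div (by fun_prop) (by fun_prop) hne2)))
      (by fun_prop)) (by fun_prop) hne
  obtain ⟨C, hC⟩ := (isCompact_Icc.prod isCompact_Icc).exists_bound_of_continuousOn hcont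
  have key := (intervalIntegral.hasDerivAt_integral_of_dominated_loc_of_deriv_le (μ := volume)
    (a := 0) (b := w) (bound := fun _ => C)
    (F := fun r x => (1 / (2 * Real.pi)) * Real.exp (-x ^ 2 / 2) *
      HH ((Real.sqrt (1 - r ^ 2))⁻¹ * (w - r * x)))
    (F' := fun r x => f r x w * (x - r * w) / (1 - r ^ 2)) hKn
    (Filter.Eventually.of_forall fun r => (hFc r).aestronglyMeasurable)
    ((hFc ρ).intervalIntegrable _ _) hF'c.aestronglyMeasurable
    (Filter.Eventually.of_forall fun t ht r hr => hC (r, t) ⟨hr, by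
      rw [Set.uIoc_of_le hw.le] at ht
      exact ⟨ht.1.le, ht.2⟩⟩)
    intervalIntegrable_const
    (Filter.Eventually.of_forall fun t _ r hr => inner_deriv r t w (hKp r hr))).2
  have hval : ∫ x in (0:ℝ)..w, f ρ x w * (x - ρ * w) / (1 - ρ ^ 2) = - f ρ w w - - f ρ 0 w :=
    intervalIntegral.integral_eq_sub_of_hasDerivAt (fun x _ => f_deriv ρ x w hρ)
      (hF'c.intervalIntegrable _ _)
  rw [hval] at key
  have key2 := key.congr_of_eventuallyEq (f₁ := fun r => P23 r w) (by
    filter_upwards [hKn] with r hr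
    simp only [P23]
    congr 1
    funext x
    exact inner_eq r x w (hKp r hr))
  refine key2.congr_deriv ?_
  simp only [f]
  have a1 : -(w ^ 2 - 2 * ρ * w * w + w ^ 2) / (2 * (1 - ρ ^ 2)) = -w ^ 2 / (1 + ρ) := by
    have : 1 + ρ ≠ 0 := by linarith
    rw [div_eq_div_iff (by positivity) this]
    ring
  have a2 : -((0:ℝ) ^ 2 - 2 * ρ * 0 * w + w ^ 2) / (2 * (1 - ρ ^ 2)) =
      -w ^ 2 / (2 * (1 - ρ ^ 2)) := by ring
  rw [a1, a2, one_div_mul_one_div]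
  ring
end

section
/- For every real ρ with −1 < ρ < 1, the probability under the standard bivariate normal distribution with correlation ρ that the two coordinates have the same sign satisfies ∫₀^∞ ∫₀^∞ f_ρ(x,y) dy dx + ∫_{−∞}^0 ∫_{−∞}^0 f_ρ(x,y) dy dx = 1 − arccos(ρ)/π. -/
open MeasureTheory Real

lemma aux_int (b : ℝ) (hb : 0 < b) :
    IntegrableOn (fun x : ℝ => x * exp (-b * x ^ 2)) (Set.Ioi 0) :=
  (integrable_mul_exp_neg_mul_sq hb).integrableOn

lemma aux_val (u : ℝ) :
    ∫ x in Set.Ioi (0:ℝ), x * exp (-((1 + u ^ 2) / 2) * x ^ 2) = (1 + u ^ 2)⁻¹ := by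
  have hb : 0 < (1 + u ^ 2) / 2 := by positivity
  have h := integral_rpow_mul_exp_neg_mul_rpow (p := 2) (q := 1) (b := (1 + u ^ 2) / 2)
    (by norm_num) (by norm_num) hb
  norm_num [Real.Gamma_one] at h
  rw [Real.rpow_neg_one] at h
  have h3 : ((1 + u ^ 2) / 2)⁻¹ * (1 / 2) = (1 + u ^ 2)⁻¹ := by field_simp
  rw [← h3]
  convert h using 1
  simp

lemma aux_subst (ρ x : ℝ) (h1 : -1 < ρ) (h2 : ρ < 1) (hx : 0 < x) :
    ∫ y in Set.Ioi (0:ℝ), f ρ x y =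
      ∫ u in Set.Ioi (-(ρ / √(1 - ρ ^ 2))),
        (1 / (2 * π)) * (x * exp (-((1 + u ^ 2) / 2) * x ^ 2)) := by
  have hr : 0 < 1 - ρ ^ 2 := by nlinarith
  have hs : 0 < √(1 - ρ ^ 2) := Real.sqrt_pos.2 hr
  have hsq : √(1 - ρ ^ 2) ^ 2 = 1 - ρ ^ 2 := Real.sq_sqrt hr.le
  have e1 : ∫ y in Set.Ioi (0:ℝ), f ρ x y = ∫ z in Set.Ioi (-(ρ * x)), f ρ x (ρ * x + z) := by
    rw [← integral_indicator measurableSet_Ioi, ← integral_indicator measurableSet_Ioi,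
      ← integral_add_left_eq_self _ (ρ * x)]
    congr 1
    ext z
    simp only [Set.indicator_apply, Set.mem_Ioi, neg_lt_iff_pos_add']
  have e2 : -(ρ * x) = (√(1 - ρ ^ 2) * x) * (-(ρ / √(1 - ρ ^ 2))) := by field_simp
  rw [e1, e2, ← integral_comp_mul_left_Ioi' (fun z => f ρ x (ρ * x + z)) _ (mul_pos hs hx),
    smul_eq_mul, ← integral_const_mul]
  refine integral_congr_ae (Filter.Eventually.of_forall fun u => ?_)
  simp only [f]
  have e3 : -(x ^ 2 - 2 * ρ * x * (ρ * x + √(1 - ρ ^ 2) * x * u)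
      + (ρ * x + √(1 - ρ ^ 2) * x * u) ^ 2) / (2 * (1 - ρ ^ 2)) =
      -((1 + u ^ 2) / 2) * x ^ 2 := by
    rw [div_eq_iff (by positivity)]
    linear_combination (-(x ^ 2 * u ^ 2)) * hsq
  rw [e3]
  field_simp

lemma aux_quad (ρ : ℝ) (h1 : -1 < ρ) (h2 : ρ < 1) :
    ∫ x in Set.Ioi (0:ℝ), ∫ y in Set.Ioi (0:ℝ), f ρ x y =
      (1 / (2 * π)) * (π - arccos ρ) := by
  rw [setIntegral_congr_fun measurableSet_Ioi (fun x hx => aux_subst ρ x h1 h2 hx)]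
  simp_rw [integral_const_mul (1 / (2 * π))]
  rw [integral_integral_swap]
  · simp_rw [aux_val]
    rw [integral_Ioi_inv_one_add_sq, arctan_neg, ← arcsin_eq_arctan ⟨h1, h2⟩, arccos]
    ring
  · rw [integrable_prod_iff']
    · refine ⟨Filter.Eventually.of_forall fun u => aux_int ((1 + u ^ 2) / 2) (by positivity), ?_⟩
      refine (integrable_inv_one_add_sq.integrableOn).congr
        (Filter.Eventually.of_forall fun u => ?_)
      simp only [Function.uncurry]
      rw [← aux_val]
      refine setIntegral_congr_fun measurableSet_Ioi fun x hx => ?_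
      have : (0:ℝ) < x := hx
      exact (Real.norm_of_nonneg (by positivity)).symm
    · refine Continuous.aestronglyMeasurable ?_
      unfold Function.uncurry
      fun_prop

lemma aux_neg (g : ℝ → ℝ) : ∫ x in Set.Iio (0:ℝ), g x = ∫ x in Set.Ioi (0:ℝ), g (-x) := by
  rw [integral_comp_neg_Ioi, neg_zero, integral_Iic_eq_integral_Iio]

theorem stmt13 (ρ : ℝ) (h1 : -1 < ρ) (h2 : ρ < 1) :
    (∫ x in Set.Ioi (0:ℝ), ∫ y in Set.Ioi (0:ℝ), f ρ x y) +
      (∫ x in Set.Iio (0:ℝ), ∫ y in Set.Iio (0:ℝ), f ρ x y) =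
      1 - Real.arccos ρ / Real.pi := by
  have hn : ∀ x y, f ρ (-x) (-y) = f ρ x y := by
    intro x y
    simp [f]
  simp_rw [aux_neg, hn]
  rw [aux_quad ρ h1 h2]
  have := Real.pi_ne_zero
  field_simp
  ring
end

section
/- For every w > 0 and every ρ with −1 < ρ < 1, the probability under the standard bivariate normal distribution with correlation ρ that the two coordinates fall in the same bin of the uniform quantizer x ↦ ⌊x/w⌋ satisfies: the measure of the set {(x,y) ∈ ℝ² : ⌊x/w⌋ = ⌊y/w⌋} with respect to the measure with density f_ρ equals 2·Σ_{i=0}^∞ ∫_{iw}^{(i+1)w} φ(z)·[ Φ(((i+1)w − ρz)/√(1−ρ²)) − Φ((iw − ρz)/√(1−ρ²)) ] dz. -/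
open MeasureTheory Real

/-- The standard bivariate normal measure with correlation `ρ` on `ℝ × ℝ`. -/
noncomputable def biMeasure (ρ : ℝ) : Measure (ℝ × ℝ) :=
  volume.withDensity (fun p => ENNReal.ofReal (f ρ p.1 p.2))

lemma aux_phi_cont : Continuous stdPhi := by
  unfold stdPhi; fun_prop

lemma aux_phi_int : Integrable stdPhi := by
  unfold stdPhi
  have := (integrable_exp_neg_mul_sq (b := 1/2) (by norm_num)).const_mul (1 / Real.sqrt (2 * Real.pi))
  refine this.congr (Filter.Eventually.of_forall fun x => ?_)
  dsimp only
  congr 2; ring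

lemma aux_phi_nonneg (x : ℝ) : 0 ≤ stdPhi x := by unfold stdPhi; positivity

lemma aux_cdf_mono : Monotone stdCdf := by
  intro a b h
  unfold stdCdf
  exact setIntegral_mono_set aux_phi_int.integrableOn
    (Filter.Eventually.of_forall aux_phi_nonneg) (Set.Iic_subset_Iic.2 h).eventuallyLE

lemma aux_cdf_sub (a b : ℝ) : stdCdf b - stdCdf a = ∫ t in a..b, stdPhi t :=
  intervalIntegral.integral_Iic_sub_Iic aux_phi_int.integrableOn aux_phi_int.integrableOn

lemma aux_f_cont (ρ : ℝ) : Continuous (fun p : ℝ × ℝ => f ρ p.1 p.2) := by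
  unfold f; fun_prop

lemma aux_f_nonneg (ρ x y : ℝ) : 0 ≤ f ρ x y := by
  unfold f; positivity

lemma aux_f_neg (ρ x y : ℝ) : f ρ (-x) (-y) = f ρ x y := by
  unfold f; congr 3; ring

lemma aux_f_eq (ρ : ℝ) (h : 0 < 1 - ρ ^ 2) (x y : ℝ) :
    f ρ x y = (stdPhi x * (1 / √(1 - ρ ^ 2))) * stdPhi (y / √(1 - ρ ^ 2) - ρ * x / √(1 - ρ ^ 2)) := by
  unfold f stdPhi
  have hs : 0 < √(1 - ρ ^ 2) := Real.sqrt_pos.2 h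
  have hs2 : √(1 - ρ ^ 2) ^ 2 = 1 - ρ ^ 2 := Real.sq_sqrt h.le
  have hp : √(2 * π) * √(2 * π) = 2 * π := Real.mul_self_sqrt (by positivity)
  have e : -(x ^ 2 - 2 * ρ * x * y + y ^ 2) / (2 * (1 - ρ ^ 2)) =
      -x ^ 2 / 2 + -(y / √(1 - ρ ^ 2) - ρ * x / √(1 - ρ ^ 2)) ^ 2 / 2 := by
    rw [← sub_div, div_pow, hs2]
    field_simp
    ring
  rw [e, Real.exp_add, ← hp]
  field_simp
  rw [Real.sqrt_sq (Real.sqrt_nonneg _)]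

lemma aux_inner (ρ : ℝ) (h : 0 < 1 - ρ ^ 2) (x a b : ℝ) :
    ∫ y in a..b, f ρ x y = stdPhi x * (stdCdf ((b - ρ * x) / √(1 - ρ ^ 2)) -
      stdCdf ((a - ρ * x) / √(1 - ρ ^ 2))) := by
  have hs : 0 < √(1 - ρ ^ 2) := Real.sqrt_pos.2 h
  simp_rw [aux_f_eq ρ h]
  rw [intervalIntegral.integral_const_mul,
    intervalIntegral.integral_comp_div_sub (fun y => stdPhi y) hs.ne', aux_cdf_sub, sub_div, sub_div,
    smul_eq_mul]
  field_simp

lemma aux_box (ρ : ℝ) (h : 0 < 1 - ρ ^ 2) (a b : ℝ) (hab : a ≤ b) :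
    (biMeasure ρ (Set.Ico a b ×ˢ Set.Ico a b)).toReal = ∫ z in a..b,
      stdPhi z * (stdCdf ((b - ρ * z) / √(1 - ρ ^ 2)) - stdCdf ((a - ρ * z) / √(1 - ρ ^ 2))) := by
  have hm := aux_f_cont ρ
  unfold biMeasure
  rw [withDensity_apply _ (measurableSet_Ico.prod measurableSet_Ico), Measure.volume_eq_prod,
    setLIntegral_prod _ (by fun_prop)]
  have inner : ∀ x, ∫⁻ y in Set.Ico a b, ENNReal.ofReal (f ρ x y) = ENNReal.ofReal
      (stdPhi x * (stdCdf ((b - ρ * x) / √(1 - ρ ^ 2)) - stdCdf ((a - ρ * x) / √(1 - ρ ^ 2)))) := by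
    intro x
    have hc : Continuous (fun y => f ρ x y) := by unfold f; fun_prop
    rw [← aux_inner ρ h, intervalIntegral.integral_of_le hab, ← integral_Ico_eq_integral_Ioc,
      ofReal_integral_eq_lintegral_ofReal]
    · exact (hc.integrableOn_Icc).mono_set Set.Ico_subset_Icc_self
    · exact Filter.Eventually.of_forall fun y => aux_f_nonneg ρ x y
  simp only [inner]
  rw [intervalIntegral.integral_of_le hab, ← integral_Ico_eq_integral_Ioc,
    integral_eq_lintegral_of_nonneg_ae]
  · refine Filter.Eventually.of_forall fun x => ?_
    refine mul_nonneg (aux_phi_nonneg x) (sub_nonneg.2 (aux_cdf_mono ?_))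
    gcongr
  · have h1 := aux_cdf_mono.measurable
    have h2 := aux_phi_cont.measurable
    exact Measurable.aestronglyMeasurable (by fun_prop)

lemma aux_fin (ρ : ℝ) (a b : ℝ) : biMeasure ρ (Set.Ico a b ×ˢ Set.Ico a b) ≠ ⊤ := by
  unfold biMeasure
  rw [withDensity_apply _ (measurableSet_Ico.prod measurableSet_Ico)]
  have : IntegrableOn (fun p : ℝ × ℝ => f ρ p.1 p.2) (Set.Ico a b ×ˢ Set.Ico a b) :=
    ((aux_f_cont ρ).continuousOn.integrableOn_compact
      (isCompact_Icc.prod isCompact_Icc : IsCompact (Set.Icc a b ×ˢ Set.Icc a b))).mono_set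
      (Set.prod_mono Set.Ico_subset_Icc_self Set.Ico_subset_Icc_self)
  rw [← ofReal_integral_eq_lintegral_ofReal this
    (Filter.Eventually.of_forall fun p => aux_f_nonneg ρ _ _)]
  exact ENNReal.ofReal_ne_top

lemma aux_lneg (g : ℝ → ENNReal) (a b : ℝ) :
    ∫⁻ x in Set.Ico (-b) (-a), g x = ∫⁻ x in Set.Ico a b, g (-x) := by
  have := (Measure.measurePreserving_neg (volume : Measure ℝ)).setLIntegral_comp_preimage_emb
    (MeasurableEquiv.neg ℝ).measurableEmbedding g (Set.Ioo (-b) (-a))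
  rw [setLIntegral_congr (Ioo_ae_eq_Ico (a := -b)).symm, ← this,
    setLIntegral_congr (Ioo_ae_eq_Ico (a := a)).symm]
  simp

lemma aux_box_neg (ρ a b : ℝ) : biMeasure ρ (Set.Ico (-b) (-a) ×ˢ Set.Ico (-b) (-a)) =
    biMeasure ρ (Set.Ico a b ×ˢ Set.Ico a b) := by
  have hm := aux_f_cont ρ
  unfold biMeasure
  rw [withDensity_apply _ (measurableSet_Ico.prod measurableSet_Ico),
    withDensity_apply _ (measurableSet_Ico.prod measurableSet_Ico), Measure.volume_eq_prod,
    setLIntegral_prod _ (by fun_prop), setLIntegral_prod _ (by fun_prop)]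
  simp only [aux_lneg, aux_f_neg]

lemma aux_set (w : ℝ) (hw : 0 < w) : {p : ℝ × ℝ | ⌊p.1 / w⌋ = ⌊p.2 / w⌋} =
    ⋃ k : ℤ, Set.Ico ((k : ℝ) * w) ((k + 1) * w) ×ˢ Set.Ico ((k : ℝ) * w) ((k + 1) * w) := by
  have key : ∀ (x : ℝ) (k : ℤ), x ∈ Set.Ico ((k : ℝ) * w) ((k + 1) * w) ↔ ⌊x / w⌋ = k := by
    intro x k
    rw [Int.floor_eq_iff, le_div_iff₀ hw, div_lt_iff₀ hw, Set.mem_Ico]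
  ext ⟨x, y⟩
  simp only [Set.mem_iUnion, Set.mem_prod, key, Set.mem_ofPred_eq]
  exact ⟨fun h => ⟨_, h, rfl⟩, fun ⟨k, h, h'⟩ => h.trans h'.symm⟩

lemma aux_disj (w : ℝ) (hw : 0 < w) : Pairwise (Function.onFun Disjoint fun k : ℤ =>
    Set.Ico ((k : ℝ) * w) ((k + 1) * w) ×ˢ Set.Ico ((k : ℝ) * w) ((k + 1) * w)) := by
  have key : ∀ (x : ℝ) (k : ℤ), x ∈ Set.Ico ((k : ℝ) * w) ((k + 1) * w) ↔ ⌊x / w⌋ = k := by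
    intro x k
    rw [Int.floor_eq_iff, le_div_iff₀ hw, div_lt_iff₀ hw, Set.mem_Ico]
  intro k l hkl
  refine Set.disjoint_left.2 ?_
  rintro ⟨x, y⟩ h h'
  simp only [Set.mem_prod, key] at h h'
  exact hkl (h.1.symm.trans h'.1)

theorem stmt17 (w ρ : ℝ) (hw : 0 < w) (h1 : -1 < ρ) (h2 : ρ < 1) :
    (biMeasure ρ {p : ℝ × ℝ | ⌊p.1 / w⌋ = ⌊p.2 / w⌋}).toReal =
      2 * ∑' i : ℕ, ∫ z in ((i : ℝ) * w)..(((i : ℝ) + 1) * w),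
        stdPhi z * (stdCdf ((((i : ℝ) + 1) * w - ρ * z) / Real.sqrt (1 - ρ ^ 2)) -
          stdCdf (((i : ℝ) * w - ρ * z) / Real.sqrt (1 - ρ ^ 2))) := by
  have h : 0 < 1 - ρ ^ 2 := by nlinarith
  rw [aux_set w hw, measure_iUnion (aux_disj w hw)
    (fun k => measurableSet_Ico.prod measurableSet_Ico),
    tsum_of_nat_of_neg_add_one ENNReal.summable ENNReal.summable]
  have hneg : ∀ n : ℕ, biMeasure ρ (Set.Ico (((-((n : ℤ) + 1) : ℤ) : ℝ) * w)
        ((((-((n : ℤ) + 1) : ℤ) : ℝ) + 1) * w) ×ˢ Set.Ico (((-((n : ℤ) + 1) : ℤ) : ℝ) * w)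
        ((((-((n : ℤ) + 1) : ℤ) : ℝ) + 1) * w)) =
      biMeasure ρ (Set.Ico ((n : ℝ) * w) ((n + 1) * w) ×ˢ Set.Ico ((n : ℝ) * w) ((n + 1) * w)) := by
    intro n
    rw [← aux_box_neg]
    have e1 : (((-((n : ℤ) + 1) : ℤ) : ℝ) * w) = -((n + 1) * w) := by push_cast; ring
    have e2 : ((((-((n : ℤ) + 1) : ℤ) : ℝ) + 1) * w) = -(n * w) := by push_cast; ring
    rw [e1, e2, neg_neg, neg_neg]
  simp only [hneg, Int.cast_natCast]
  rw [← two_mul, ENNReal.toReal_mul, ENNReal.tsum_toReal_eq (fun n => aux_fin ρ _ _)]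
  simp only [ENNReal.toReal_ofNat]
  congr 2
  ext n
  exact aux_box ρ h _ _ (by nlinarith)
end

section
/- For every w > 0 and every ρ with −1 < ρ < 1, set d = 2(1−ρ). The collision probability of the quantization scheme with a random offset satisfies: the measure of the set {(x,y,q) ∈ ℝ²×(0,w) : ⌊(x+q)/w⌋ = ⌊(y+q)/w⌋} with respect to the product of the measure on ℝ² with density f_ρ and the uniform probability measure on (0,w) equals ∫₀^w (1/√d)·2·φ(t/√d)·(1 − t/w) dt. -/
open MeasureTheory Real

lemma aux_set_s19 (w x y : ℝ) (hw : 0 < w) :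
    volume ({q : ℝ | ⌊(x + q) / w⌋ = ⌊(y + q) / w⌋} ∩ Set.Ioo 0 w) = ENNReal.ofReal (w - |y - x|) := by
  set S : Set ℝ := {q : ℝ | ⌊(x + q) / w⌋ = ⌊(y + q) / w⌋} with hS
  have hSm : MeasurableSet S := by
    apply measurableSet_eq_fun <;> fun_prop
  have hfin : ∀ a : ℝ, volume (S ∩ Set.Ioc a (a + w)) = volume (S ∩ Set.Ioc 0 (0 + w)) := by
    intro a
    apply (isAddFundamentalDomain_Ioc hw a volume).measure_set_eq
      (isAddFundamentalDomain_Ioc hw 0 volume)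
    · exact hSm
    rintro ⟨g, hg⟩
    obtain ⟨n, rfl⟩ := AddSubgroup.mem_zmultiples_iff.1 hg
    ext q
    simp only [hS, Set.mem_preimage, Set.mem_setOf_eq]
    have e : ∀ z : ℝ, ⌊(z + (n • w + q)) / w⌋ = ⌊(z + q) / w⌋ + n := by
      intro z
      rw [← Int.floor_add_intCast]
      congr 1
      simp only [zsmul_eq_mul]
      field_simp
      ring
    have e1 := e x
    have e2 := e y
    change ⌊(x + (n • w + q)) / w⌋ = ⌊(y + (n • w + q)) / w⌋ ↔ _
    rw [e1, e2]
    simp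
  have h0 : volume (S ∩ Set.Ioo 0 w) = volume (S ∩ Set.Ioc 0 (0 + w)) := by
    rw [zero_add]
    exact measure_congr ((Filter.EventuallyEq.refl _ S).inter Ioo_ae_eq_Ioc)
  have h3 : volume (S ∩ Set.Ioc (-x) (-x + w)) = volume (S ∩ Set.Ico (-x) (-x + w)) :=
    measure_congr ((Filter.EventuallyEq.refl _ S).inter Ico_ae_eq_Ioc.symm)
  have h4 : S ∩ Set.Ico (-x) (-x + w) = Set.Ico (max (-x) (-y)) (min (-x + w) (-y + w)) := by
    ext q
    simp only [hS, Set.mem_inter_iff, Set.mem_setOf_eq, Set.mem_Ico, max_le_iff, lt_min_iff]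
    have key : ∀ z : ℝ, ⌊(z + q) / w⌋ = 0 ↔ -z ≤ q ∧ q < -z + w := by
      intro z
      rw [Int.floor_eq_zero_iff, Set.mem_Ico, div_lt_one hw, le_div_iff₀ hw, zero_mul]
      constructor <;> rintro ⟨_, _⟩ <;> constructor <;> linarith
    constructor
    · rintro ⟨h, hx⟩
      rw [(key x).2 hx] at h
      have := (key y).1 h.symm
      tauto
    · rintro ⟨⟨a, b⟩, c, d⟩
      exact ⟨by rw [(key x).2 ⟨a, c⟩, (key y).2 ⟨b, d⟩], a, c⟩
  rw [h0, ← hfin (-x), h3, h4, Real.volume_Ico]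
  congr 1
  rcases le_total x y with h | h
  · rw [max_eq_left (by linarith), min_eq_right (by linarith), abs_of_nonneg (by linarith)]; ring
  · rw [max_eq_right (by linarith), min_eq_left (by linarith), abs_of_nonpos (by linarith)]; ring

lemma f_eq (ρ : ℝ) (h1 : -1 < ρ) (h2 : ρ < 1) (x t : ℝ) :
    f ρ x (t + x) = ProbabilityTheory.gaussianPDFReal (-t/2) (Real.toNNReal ((1 + ρ) / 2)) x *
      (1 / √(2 * (1 - ρ)) * stdPhi (t / √(2 * (1 - ρ)))) := by
  have a : 0 < 1 + ρ := by linarith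
  have b : 0 < 1 - ρ := by linarith
  have hr : 1 - ρ ^ 2 = (1 + ρ) * (1 - ρ) := by ring
  rw [f, ProbabilityTheory.gaussianPDFReal, stdPhi, Real.coe_toNNReal _ (by positivity)]
  have e1 : (√(2 * π * ((1 + ρ) / 2)))⁻¹ * rexp (-(x - -t / 2) ^ 2 / (2 * ((1 + ρ) / 2))) *
      (1 / √(2 * (1 - ρ)) * (1 / √(2 * π) * rexp (-(t / √(2 * (1 - ρ))) ^ 2 / 2)))
      = (1 / (√(2 * π * ((1 + ρ) / 2)) * √(2 * (1 - ρ)) * √(2 * π))) *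
       (rexp (-(x - -t / 2) ^ 2 / (2 * ((1 + ρ) / 2))) * rexp (-(t / √(2 * (1 - ρ))) ^ 2 / 2)) := by
    field_simp
  rw [e1, ← Real.exp_add, div_pow, Real.sq_sqrt (by positivity),
    ← Real.sqrt_mul (by positivity), ← Real.sqrt_mul (by positivity)]
  have e2 : 2 * π * √(1 - ρ ^ 2) = √(2 * π * ((1 + ρ) / 2) * (2 * (1 - ρ)) * (2 * π)) := by
    rw [show 2 * π * ((1 + ρ) / 2) * (2 * (1 - ρ)) * (2 * π) = (2 * π)^2 * (1 - ρ ^ 2) by ring,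
      Real.sqrt_mul (by positivity), Real.sqrt_sq (by positivity)]
  rw [e2, hr]
  congr 2
  field_simp
  ring

lemma f_lint (ρ : ℝ) (h1 : -1 < ρ) (h2 : ρ < 1) (t : ℝ) :
    ∫⁻ x, ENNReal.ofReal (f ρ x (t + x)) =
      ENNReal.ofReal (1 / √(2 * (1 - ρ)) * stdPhi (t / √(2 * (1 - ρ)))) := by
  simp_rw [f_eq ρ h1 h2, ENNReal.ofReal_mul (ProbabilityTheory.gaussianPDFReal_nonneg _ _ _)]
  rw [lintegral_mul_const _ (by fun_prop), ProbabilityTheory.lintegral_gaussianPDFReal_eq_one, one_mul]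
  simp; linarith

lemma f_meas (ρ : ℝ) : Measurable (fun p : ℝ × ℝ => ENNReal.ofReal (f ρ p.1 p.2)) := by
  unfold f; fun_prop

lemma f_push (ρ : ℝ) (h1 : -1 < ρ) (h2 : ρ < 1) (g : ℝ → ENNReal) (hg : Measurable g) :
    ∫⁻ p, g (p.2 - p.1) ∂(biMeasure ρ) =
      ∫⁻ t, ENNReal.ofReal (1 / √(2 * (1 - ρ)) * stdPhi (t / √(2 * (1 - ρ)))) * g t := by
  have hf := f_meas ρ
  rw [biMeasure, lintegral_withDensity_eq_lintegral_mul _ hf (by fun_prop), Measure.volume_eq_prod,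
    lintegral_prod _ (by fun_prop)]
  simp only [Pi.mul_apply]
  have : ∀ x : ℝ, ∫⁻ y, ENNReal.ofReal (f ρ x y) * g (y - x) =
      ∫⁻ t, ENNReal.ofReal (f ρ x (t + x)) * g t := by
    intro x
    rw [← lintegral_add_right_eq_self _ x]
    simp
  simp_rw [this]
  have hm : Measurable (fun p : ℝ × ℝ => ENNReal.ofReal (f ρ p.1 (p.2 + p.1))) := by
    unfold f; fun_prop
  rw [lintegral_lintegral_swap (by
    exact (hm.mul (hg.comp measurable_snd)).aemeasurable)]
  congr 1; ext t
  rw [lintegral_mul_const _ (by unfold f; fun_prop), f_lint ρ h1 h2]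

theorem stmt19 (w ρ : ℝ) (hw : 0 < w) (h1 : -1 < ρ) (h2 : ρ < 1) (d : ℝ) (hd : d = 2 * (1 - ρ)) :
    (((biMeasure ρ).prod ((ENNReal.ofReal (1 / w)) • volume.restrict (Set.Ioo 0 w)))
        {p : (ℝ × ℝ) × ℝ | ⌊(p.1.1 + p.2) / w⌋ = ⌊(p.1.2 + p.2) / w⌋}).toReal =
      ∫ t in (0:ℝ)..w, (1 / Real.sqrt d) * 2 * stdPhi (t / Real.sqrt d) * (1 - t / w) := by
  have hSm : MeasurableSet {p : (ℝ × ℝ) × ℝ | ⌊(p.1.1 + p.2) / w⌋ = ⌊(p.1.2 + p.2) / w⌋} := by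
    apply measurableSet_eq_fun <;> fun_prop
  haveI : IsFiniteMeasure ((ENNReal.ofReal (1 / w)) • volume.restrict (Set.Ioo 0 w)) :=
    Measure.smul_finite _ ENNReal.ofReal_ne_top
  rw [Measure.prod_apply hSm]
  have hsec : ∀ p : ℝ × ℝ, ((ENNReal.ofReal (1 / w)) • volume.restrict (Set.Ioo 0 w))
      (Prod.mk p ⁻¹' {p : (ℝ × ℝ) × ℝ | ⌊(p.1.1 + p.2) / w⌋ = ⌊(p.1.2 + p.2) / w⌋}) =
      (fun t => ENNReal.ofReal (1 / w) * ENNReal.ofReal (w - |t|)) (p.2 - p.1) := by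
    intro p
    rw [Measure.smul_apply, Measure.restrict_apply (hSm.preimage measurable_prodMk_left)]
    simp only [smul_eq_mul]
    rw [← aux_set_s19 w p.1 p.2 hw]
    rfl
  simp_rw [hsec]
  rw [f_push ρ h1 h2 (fun t => ENNReal.ofReal (1 / w) * ENNReal.ofReal (w - |t|)) (by fun_prop), ← hd]
  have hphi : ∀ t, 0 ≤ 1 / √d * stdPhi (t / √d) := by intro t; unfold stdPhi; positivity
  have hcomb : ∀ t : ℝ, ENNReal.ofReal (1 / √d * stdPhi (t / √d)) *
      (ENNReal.ofReal (1 / w) * ENNReal.ofReal (w - |t|)) =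
      ENNReal.ofReal ((fun s => 1 / √d * stdPhi (s / √d) * (1 / w * max (w - s) 0)) |t|) := by
    intro t
    have : stdPhi (|t| / √d) = stdPhi (t / √d) := by
      simp [stdPhi, div_pow, sq_abs]
    simp only [this]
    rw [ENNReal.ofReal_mul (hphi t), ENNReal.ofReal_mul (p := 1 / w) (by positivity)]
    congr 2
    simp [ENNReal.ofReal_max]
  simp_rw [hcomb]
  rw [← integral_eq_lintegral_of_nonneg_ae
    (Filter.Eventually.of_forall fun t => by
      exact mul_nonneg (hphi _) (by positivity))
    (by apply Measurable.aestronglyMeasurable; unfold stdPhi; fun_prop)]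
  rw [integral_comp_abs (f := fun s => 1 / √d * stdPhi (s / √d) * (1 / w * max (w - s) 0)),
    intervalIntegral.integral_of_le hw.le, ← integral_const_mul,
    setIntegral_eq_of_subset_of_forall_sdiff_eq_zero measurableSet_Ioi (s := Set.Ioc 0 w)
      (fun x hx => hx.1)]
  · apply setIntegral_congr_fun measurableSet_Ioc
    intro t ht
    simp only
    rw [max_eq_left (by linarith [ht.2])]
    field_simp
  · intro x hx
    have : w < x := by
      by_contra h
      exact hx.2 ⟨hx.1, not_lt.1 h⟩
    simp [max_eq_right (show w - x ≤ 0 by linarith)]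
end
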